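/- (Central Limit Theorem, distribution-function form.) Let f : Ω → ℝ be Lipschitz and normalized (L_f(1) ≡ 1), let μ_f be a Borel probability on Ω with ∫ L_f(w) dμ_f = ∫ w dμ_f for every bounded continuous w, and let g : Ω → ℝ be Lipschitz. Suppose λ : ℝ → (0, ∞) satisfies λ(0) = 1, that β := log ∘ λ admits a second-order Taylor expansion at 0, β(t) = β′(0)t + ½β″(0)t² + o(t²), with σ² := β″(0) > 0, and that for every z ∈ ℝ one has lim_{n→∞} λ(z/√n)^{-n} ∫_Ω L^n_{f+(z/√n)g}(1) dμ_f = 1. Then for every c ∈ ℝ, lim_{n→∞} μ_f({ x ∈ Ω : (1/√n) Σ_{j=0}^{n-1} (g(T^j x) − β′(0)) < c }) = (2πσ²)^{-1/2} ∫_{−∞}^{c} e^{−t²/(2σ²)} dt. -/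

import Mathlib

open MeasureTheory Filter Topology

noncomputable section

/-- The left shift on the sequence space `ℕ → M`. -/
def shift {M : Type*} (x : ℕ → M) : ℕ → M := fun n => x (n + 1)

/-- Prepending a symbol `a` to a sequence `x`, so that `shift (cons' a x) = x`. -/
def cons' {M : Type*} (a : M) (x : ℕ → M) : ℕ → M
  | 0 => a
  | n + 1 => x n

/-- The metric `d(x,y) = Σ_n 2⁻ⁿ d_M(x_n, y_n)` on the sequence space `Ω = M^ℕ`. -/
def seqDist {M : Type*} [MetricSpace M] (x y : ℕ → M) : ℝ :=
  ∑' n : ℕ, (1 / 2 : ℝ) ^ n * dist (x n) (y n)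

/-- A function `Ω → ℝ` is Lipschitz for the metric `seqDist`. -/
def LipschitzSeq {M : Type*} [MetricSpace M] (f : (ℕ → M) → ℝ) : Prop :=
  ∃ K : ℝ, 0 ≤ K ∧ ∀ x y, |f x - f y| ≤ K * seqDist x y

/-- The Ruelle operator with a priori measure `ν` and potential `f`. -/
def ruelle {M : Type*} [MeasurableSpace M] (ν : Measure M)
    (f w : (ℕ → M) → ℝ) : (ℕ → M) → ℝ :=
  fun x => ∫ a, Real.exp (f (cons' a x)) * w (cons' a x) ∂ν

open Asymptotics

open ProbabilityTheory

lemma mgf_limit {U : Filter ℕ} [U.NeBot] (P : ℕ → ProbabilityMeasure ℝ) (Q : ProbabilityMeasure ℝ)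
    (hint : ∀ n z, Integrable (fun x => Real.exp (z * x)) (P n : Measure ℝ))
    (z m C : ℝ) (hC : ∀ n, ∫ x, Real.exp ((2 * z) * x) ∂(P n : Measure ℝ) ≤ C)
    (hm : Tendsto (fun n => ∫ x, Real.exp (z * x) ∂(P n : Measure ℝ)) U (𝓝 m))
    (hQ : Tendsto P U (𝓝 Q)) :
    ∫ x, Real.exp (z * x) ∂(Q : Measure ℝ) = m := by
  have hbd : ∀ (K : ℕ) (x : ℝ), ‖min (Real.exp (z * x)) (K : ℝ)‖ ≤ K := by
    intro K x
    rw [Real.norm_eq_abs, abs_of_nonneg (le_min (Real.exp_pos _).le (Nat.cast_nonneg _))]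
    exact min_le_right _ _
  let h : ℕ → BoundedContinuousFunction ℝ ℝ := fun K =>
    BoundedContinuousFunction.ofNormedAddCommGroup (fun x => min (Real.exp (z * x)) (K : ℝ))
      (by fun_prop) K (hbd K)
  have hh : ∀ K x, h K x = min (Real.exp (z * x)) (K : ℝ) := fun K x => rfl
  have hlim : ∀ K, Tendsto (fun n => ∫ x, h K x ∂(P n : Measure ℝ)) U
      (𝓝 (∫ x, h K x ∂(Q : Measure ℝ))) := fun K =>
    (ProbabilityMeasure.tendsto_iff_forall_integral_tendsto.1 hQ) (h K)
  have hm0 : 0 ≤ m := ge_of_tendsto' hm fun n => integral_nonneg fun x => (Real.exp_pos _).le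
  have hest : ∀ (K : ℕ), 0 < K → |m - ∫ x, h K x ∂(Q : Measure ℝ)| ≤ C / K := by
    intro K hK
    have hK' : (0 : ℝ) < K := by exact_mod_cast hK
    refine le_of_tendsto' ((hm.sub (hlim K)).abs) fun n => ?_
    have hi : Integrable (fun x => h K x) (P n : Measure ℝ) :=
      BoundedContinuousFunction.integrable _ _
    rw [← integral_sub (hint n z) hi]
    have hpt : ∀ x, 0 ≤ Real.exp (z * x) - h K x ∧
        Real.exp (z * x) - h K x ≤ Real.exp ((2 * z) * x) / K := by
      intro x
      rw [hh]
      have e : Real.exp ((2 * z) * x) = Real.exp (z * x) * Real.exp (z * x) := by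
        rw [← Real.exp_add]; ring_nf
      have hp := Real.exp_pos (z * x)
      refine ⟨by linarith [min_le_left (Real.exp (z * x)) (K : ℝ)], ?_⟩
      rw [le_div_iff₀ hK', e]
      rcases le_total (Real.exp (z * x)) (K : ℝ) with h1 | h1
      · rw [min_eq_left h1]; nlinarith
      · rw [min_eq_right h1]; nlinarith
    rw [abs_of_nonneg (integral_nonneg fun x => (hpt x).1)]
    calc _ ≤ ∫ x, Real.exp ((2 * z) * x) / K ∂(P n : Measure ℝ) :=
          integral_mono ((hint n z).sub hi) ((hint n _).div_const _) fun x => (hpt x).2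
      _ ≤ C / K := by
          rw [integral_div]; gcongr; exact hC n
  have hconv : Tendsto (fun K : ℕ => ∫ x, h K x ∂(Q : Measure ℝ)) atTop (𝓝 m) := by
    rw [tendsto_iff_dist_tendsto_zero]
    refine squeeze_zero' (Eventually.of_forall fun _ => dist_nonneg) ?_
      (tendsto_const_div_atTop_nhds_zero_nat C)
    filter_upwards [eventually_gt_atTop 0] with K hK
    rw [dist_comm, Real.dist_eq]; exact hest K hK
  have h1 : Tendsto (fun K : ℕ => ∫⁻ x, ENNReal.ofReal (h K x) ∂(Q : Measure ℝ)) atTop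
      (𝓝 (∫⁻ x, ENNReal.ofReal (Real.exp (z * x)) ∂(Q : Measure ℝ))) := by
    refine lintegral_tendsto_of_tendsto_of_monotone (fun K => ?_) (ae_of_all _ fun x => ?_)
      (ae_of_all _ fun x => ?_)
    · exact ((h K).continuous.measurable.ennreal_ofReal).aemeasurable
    · intro a b hab
      refine ENNReal.ofReal_le_ofReal ?_
      rw [hh, hh]
      exact min_le_min_left _ (by exact_mod_cast hab)
    · refine tendsto_const_nhds.congr' ?_
      filter_upwards [eventually_ge_atTop ⌈Real.exp (z * x)⌉₊] with K hK
      rw [hh, min_eq_left (Nat.ceil_le.1 hK)]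
  have h2 : Tendsto (fun K : ℕ => ∫⁻ x, ENNReal.ofReal (h K x) ∂(Q : Measure ℝ)) atTop
      (𝓝 (ENNReal.ofReal m)) := by
    refine (ENNReal.tendsto_ofReal hconv).congr fun K => ?_
    refine ofReal_integral_eq_lintegral_ofReal (BoundedContinuousFunction.integrable _ _)
      (ae_of_all _ fun x => ?_)
    exact le_min (Real.exp_pos _).le (Nat.cast_nonneg _)
  rw [integral_eq_lintegral_of_nonneg_ae (ae_of_all _ fun x => (Real.exp_pos _).le)
    (by fun_prop), tendsto_nhds_unique h1 h2, ENNReal.toReal_ofReal hm0]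

lemma curtiss (P : ℕ → ProbabilityMeasure ℝ) (P0 : ProbabilityMeasure ℝ)
    (hint : ∀ n z, Integrable (fun x => Real.exp (z * x)) (P n : Measure ℝ))
    (hint0 : ∀ z, Integrable (fun x => Real.exp (z * x)) (P0 : Measure ℝ))
    (h : ∀ z, Tendsto (fun n => ∫ x, Real.exp (z * x) ∂(P n : Measure ℝ)) atTop
      (𝓝 (∫ x, Real.exp (z * x) ∂(P0 : Measure ℝ)))) :
    Tendsto P atTop (𝓝 P0) := by
  have hB : ∀ z, ∃ C, ∀ n, ∫ x, Real.exp (z * x) ∂(P n : Measure ℝ) ≤ C := by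
    intro z
    obtain ⟨C, hC⟩ := (h z).bddAbove_range
    exact ⟨C, fun n => hC ⟨n, rfl⟩⟩
  choose C hC using hB
  have htight : IsTightMeasureSet {((μ : ProbabilityMeasure ℝ) : Measure ℝ) | μ ∈ Set.range P} := by
    rw [isTightMeasureSet_iff_exists_isCompact_measure_compl_le]
    intro ε hε
    have hlim : Tendsto (fun r : ℝ => ENNReal.ofReal (Real.exp (-r) * (C 1 + C (-1)))) atTop
        (𝓝 0) := by
      have := (Real.tendsto_exp_neg_atTop_nhds_zero).mul_const (C 1 + C (-1))
      simpa using ENNReal.tendsto_ofReal this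
    obtain ⟨r, hr⟩ := (hlim.eventually (ge_mem_nhds hε)).exists
    refine ⟨Set.Icc (-r) r, isCompact_Icc, ?_⟩
    rintro _ ⟨_, ⟨n, rfl⟩, rfl⟩
    refine le_trans ?_ hr
    have a1 := measure_ge_le_exp_mul_mgf (X := id) (μ := (P n : Measure ℝ)) r zero_le_one
      (hint n 1)
    have a2 := measure_le_le_exp_mul_mgf (X := id) (μ := (P n : Measure ℝ)) (-r)
      (by norm_num : (-1 : ℝ) ≤ 0) (hint n (-1))
    have b1 : mgf id (P n : Measure ℝ) 1 ≤ C 1 := hC 1 n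
    have b2 : mgf id (P n : Measure ℝ) (-1) ≤ C (-1) := hC (-1) n
    have hsub : (Set.Icc (-r) r)ᶜ ⊆ {ω : ℝ | r ≤ id ω} ∪ {ω : ℝ | id ω ≤ -r} := by
      intro x hx
      simp only [Set.mem_compl_iff, Set.mem_Icc, not_and_or, not_le] at hx
      rcases hx with hx | hx
      · right; exact hx.le
      · left; exact hx.le
    rw [← ENNReal.ofReal_toReal (measure_ne_top (P n : Measure ℝ) (Set.Icc (-r) r)ᶜ)]
    refine ENNReal.ofReal_le_ofReal ?_
    have c1 := measureReal_mono (μ := (P n : Measure ℝ)) hsub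
    have c2 := measureReal_union_le (μ := (P n : Measure ℝ)) {ω : ℝ | r ≤ id ω} {ω : ℝ | id ω ≤ -r}
    have hp := Real.exp_pos (-r)
    have e1 : -1 * r = -r := by ring
    have e2 : - (-1) * (-r) = -r := by ring
    rw [e1] at a1
    rw [e2] at a2
    change (P n : Measure ℝ).real _ ≤ _
    nlinarith [mul_le_mul_of_nonneg_left b1 hp.le, mul_le_mul_of_nonneg_left b2 hp.le]
  have hcomp := isCompact_closure_of_isTightMeasureSet htight
  rw [tendsto_iff_ultrafilter]
  intro U hU
  have hmem : ((U.map P : Ultrafilter _) : Filter _) ≤ 𝓟 (closure (Set.range P)) := by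
    rw [le_principal_iff]
    exact Filter.mem_of_superset (Filter.range_mem_map) subset_closure
  obtain ⟨Q, -, hQ⟩ := hcomp.ultrafilter_le_nhds _ hmem
  have hQ' : Tendsto P U (𝓝 Q) := hQ
  have hmgf : mgf id (P0 : Measure ℝ) = mgf id (Q : Measure ℝ) := by
    funext z
    exact (mgf_limit P Q hint z _ (C (2 * z)) (hC (2 * z)) ((h z).mono_left hU) hQ').symm
  have hset : integrableExpSet id (P0 : Measure ℝ) = Set.univ := by
    ext z; simpa [integrableExpSet] using hint0 z
  have hc := eqOn_complexMGF_of_mgf hmgf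
  rw [hset] at hc
  have : (P0 : Measure ℝ) = Q := Measure.ext_of_complexMGF_id_eq (by
    funext z; exact hc (by simp))
  have : P0 = Q := Subtype.ext this
  rw [this]; exact hQ'

lemma gauss_val {v : NNReal} (hv : v ≠ 0) (c : ℝ) :
    (gaussianReal 0 v (Set.Iio c)).toReal = (Real.sqrt (2 * Real.pi * v))⁻¹ *
          ∫ t in Set.Iio c, Real.exp (-t ^ 2 / (2 * v)) := by
  rw [gaussianReal_apply_eq_integral _ hv, ENNReal.toReal_ofReal
    (integral_nonneg fun x => gaussianPDFReal_nonneg _ _ _)]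
  simp only [gaussianPDFReal, sub_zero]
  rw [integral_const_mul]

lemma shift_cons' {M : Type*} (a : M) (x : ℕ → M) : shift (cons' a x) = x := rfl

lemma continuous_shift {M : Type*} [TopologicalSpace M] :
    Continuous (shift : (ℕ → M) → (ℕ → M)) :=
  continuous_pi fun n => continuous_apply (n + 1)

lemma continuous_cons' {M : Type*} [TopologicalSpace M] :
    Continuous (fun p : (ℕ → M) × M => cons' p.2 p.1) := by
  refine continuous_pi fun n => ?_
  cases n with
  | zero => exact continuous_snd
  | succ n => exact (continuous_apply n).comp continuous_fst

lemma LipschitzSeq.cont {M : Type*} [MetricSpace M] [CompactSpace M] {f : (ℕ → M) → ℝ}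
    (hf : LipschitzSeq f) : Continuous f := by
  obtain ⟨K, hK, h⟩ := hf
  rw [continuous_iff_continuousAt]
  intro x
  have hs : Continuous (fun y => K * seqDist y x) := by
    refine continuous_const.mul ?_
    unfold seqDist
    refine continuous_tsum (u := fun n => (1 / 2 : ℝ) ^ n * Metric.diam (Set.univ : Set M))
      (fun n => ?_) ?_ ?_
    · exact continuous_const.mul ((continuous_apply n).dist continuous_const)
    · exact summable_geometric_two.mul_right _
    · intro n y
      rw [Real.norm_eq_abs, abs_of_nonneg (by positivity)]
      gcongr
      exact Metric.dist_le_diam_of_mem (isCompact_univ.isBounded) trivial trivial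
  have h0 : K * seqDist x x = 0 := by simp [seqDist]
  rw [ContinuousAt, tendsto_iff_dist_tendsto_zero]
  refine squeeze_zero (fun _ => dist_nonneg) (fun y => ?_) (h0 ▸ hs.tendsto x)
  rw [Real.dist_eq]; exact h y x

lemma continuous_ruelle {M : Type*} [MetricSpace M] [CompactSpace M]
    [MeasurableSpace M] [BorelSpace M]
    (ν : Measure M) [IsProbabilityMeasure ν] {f w : (ℕ → M) → ℝ}
    (hf : Continuous f) (hw : Continuous w) : Continuous (ruelle ν f w) := by
  have : Continuous (Function.uncurry fun (x : ℕ → M) (a : M) =>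
      Real.exp (f (cons' a x)) * w (cons' a x)) :=
    ((Real.continuous_exp.comp (hf.comp continuous_cons')).mul (hw.comp continuous_cons'))
  have h2 := continuous_parametric_integral_of_continuous (μ := ν) this
    (isCompact_univ : IsCompact (Set.univ : Set M))
  simp only [Measure.restrict_univ] at h2
  exact h2

lemma continuous_birkhoff {M : Type*} [TopologicalSpace M] {g : (ℕ → M) → ℝ}
    (hg : Continuous g) (n : ℕ) :
    Continuous (fun x => ∑ j ∈ Finset.range n, g (shift^[j] x)) :=
  continuous_finsetSum _ fun j _ => hg.comp (continuous_shift.iterate j)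

lemma integral_ruelle_iterate {M : Type*} [MetricSpace M] [CompactSpace M]
    [MeasurableSpace M] [BorelSpace M]
    (ν : Measure M) [IsProbabilityMeasure ν]
    {f : (ℕ → M) → ℝ} (hf : Continuous f)
    (μ : Measure (ℕ → M)) 
    (hfix : ∀ w : (ℕ → M) → ℝ, Continuous w →
      ∫ x, ruelle ν f w x ∂μ = ∫ x, w x ∂μ)
    {g : (ℕ → M) → ℝ} (hg : Continuous g) (s : ℝ) (n : ℕ) :
    ∀ w : (ℕ → M) → ℝ, Continuous w →
    ∫ x, (ruelle ν (fun y => f y + s * g y))^[n] w x ∂μ =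
      ∫ x, Real.exp (s * ∑ j ∈ Finset.range n, g (shift^[j] x)) * w x ∂μ := by
  induction n with
  | zero => intro w _; simp
  | succ n ih =>
    intro w hw
    have hfg : Continuous (fun y => f y + s * g y) := hf.add (continuous_const.mul hg)
    have hB := continuous_birkhoff hg n
    rw [Function.iterate_succ_apply, ih _ (continuous_ruelle ν hfg hw)]
    have hcont : Continuous (fun x => Real.exp (s * ∑ j ∈ Finset.range (n + 1),
        g (shift^[j] x)) * w x) :=
      (Real.continuous_exp.comp (continuous_const.mul (continuous_birkhoff hg (n + 1)))).mul hw
    rw [← hfix _ hcont]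
    congr 1
    funext x
    simp only [ruelle]
    rw [← integral_const_mul]
    congr 1
    funext a
    rw [Finset.sum_range_succ']
    simp only [Function.iterate_succ_apply, shift_cons', Function.iterate_zero_apply, mul_add,
      Real.exp_add]
    ring

lemma taylor_limit (lam : ℝ → ℝ) (hlampos : ∀ t, 0 < lam t) (β1 σ2 : ℝ)
    (hTaylor : (fun t => Real.log (lam t) - (β1 * t + σ2 / 2 * t ^ 2))
      =o[𝓝 (0 : ℝ)] fun t => t ^ 2) (z : ℝ) :
    Tendsto (fun n : ℕ => lam (z / Real.sqrt (n : ℝ)) ^ n * Real.exp (-(z * Real.sqrt n * β1)))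
      atTop (𝓝 (Real.exp (σ2 * z ^ 2 / 2))) := by
  have ht : Tendsto (fun n : ℕ => z / Real.sqrt (n : ℝ)) atTop (𝓝 0) :=
    tendsto_const_nhds.div_atTop (Real.tendsto_sqrt_atTop.comp tendsto_natCast_atTop_atTop)
  have h1 := hTaylor.comp_tendsto ht
  have h2 : Tendsto (fun n : ℕ => (n : ℝ) * (Real.log (lam (z / Real.sqrt n)) -
      (β1 * (z / Real.sqrt n) + σ2 / 2 * (z / Real.sqrt n) ^ 2))) atTop (𝓝 0) := by
    have h3 : (fun n : ℕ => (n : ℝ) * (Real.log (lam (z / Real.sqrt n)) -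
      (β1 * (z / Real.sqrt n) + σ2 / 2 * (z / Real.sqrt n) ^ 2))) =o[atTop]
        (fun n : ℕ => (n : ℝ) * (z / Real.sqrt n) ^ 2) :=
      (isBigO_refl (fun n : ℕ => (n : ℝ)) atTop).mul_isLittleO h1
    have h4 : (fun n : ℕ => (n : ℝ) * (z / Real.sqrt n) ^ 2) =ᶠ[atTop] fun _ => z ^ 2 := by
      filter_upwards [eventually_gt_atTop 0] with n hn
      have : (0 : ℝ) < n := by exact_mod_cast hn
      rw [div_pow, Real.sq_sqrt this.le]
      field_simp
    have h5 := h3.trans_eventuallyEq h4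
    have h6 : (fun _ : ℕ => z ^ 2) =O[atTop] (fun _ : ℕ => (1 : ℝ)) :=
      isBigO_const_const _ one_ne_zero _
    exact (isLittleO_one_iff ℝ).1 (h5.trans_isBigO h6)
  have h7 := (Real.continuous_exp.tendsto _).comp (h2.add_const (σ2 * z ^ 2 / 2))
  rw [zero_add] at h7
  refine h7.congr' ?_
  filter_upwards [eventually_gt_atTop 0] with n hn
  have hn' : (0 : ℝ) < n := by exact_mod_cast hn
  have hs : 0 < Real.sqrt n := Real.sqrt_pos.2 hn'
  have hss : Real.sqrt n * Real.sqrt n = n := Real.mul_self_sqrt hn'.le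
  rw [← Real.exp_log (pow_pos (hlampos (z / Real.sqrt n)) n), ← Real.exp_add, Real.log_pow]
  simp only [Function.comp]
  congr 1
  have e1 : (n : ℝ) * (z / Real.sqrt n) = z * Real.sqrt n := by
    rw [mul_div_assoc', div_eq_iff hs.ne', mul_assoc, hss, mul_comm]
  have e2 : (n : ℝ) * (z / Real.sqrt n) ^ 2 = z ^ 2 := by
    rw [div_pow, Real.sq_sqrt hn'.le]; field_simp
  linear_combination (-β1) * e1 - σ2 / 2 * e2

/-- the Central Limit Theorem for Lipschitz-Gibbs probabilities,
distribution-function form. -/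
theorem stmt_8 {M : Type*} [MetricSpace M] [CompactSpace M]
    [MeasurableSpace M] [BorelSpace M]
    (ν : Measure M) [IsProbabilityMeasure ν] [ν.IsOpenPosMeasure]
    (f : (ℕ → M) → ℝ) (hf : LipschitzSeq f)
    (hnorm : ∀ x, ruelle ν f (fun _ => (1 : ℝ)) x = 1)
    (μ : Measure (ℕ → M)) [IsProbabilityMeasure μ]
    (hfix : ∀ w : (ℕ → M) → ℝ, Continuous w →
      ∫ x, ruelle ν f w x ∂μ = ∫ x, w x ∂μ)
    (g : (ℕ → M) → ℝ) (hg : LipschitzSeq g)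
    (lam : ℝ → ℝ) (hlampos : ∀ t, 0 < lam t) (hlam0 : lam 0 = 1)
    (β1 σ2 : ℝ) (hσ2 : 0 < σ2)
    (hTaylor : (fun t => Real.log (lam t) - (β1 * t + σ2 / 2 * t ^ 2))
      =o[𝓝 (0 : ℝ)] fun t => t ^ 2)
    (hspec : ∀ z : ℝ,
      Tendsto
        (fun n : ℕ =>
          ((lam (z / Real.sqrt (n : ℝ))) ^ n)⁻¹ *
            ∫ x, (ruelle ν (fun y => f y + (z / Real.sqrt (n : ℝ)) * g y))^[n]
              (fun _ => (1 : ℝ)) x ∂μ)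
        atTop (𝓝 1)) :
    ∀ c : ℝ,
      Tendsto
        (fun n : ℕ =>
          (μ {x : ℕ → M |
            (1 / Real.sqrt (n : ℝ)) *
              ∑ j ∈ Finset.range n, (g (shift^[j] x) - β1) < c}).toReal)
        atTop
        (𝓝 ((Real.sqrt (2 * Real.pi * σ2))⁻¹ *
          ∫ t in Set.Iio c, Real.exp (-t ^ 2 / (2 * σ2)))) := by
  intro c
  have hfc := hf.cont
  have hgc := hg.cont
  set Y : ℕ → (ℕ → M) → ℝ := fun n x =>
    (1 / Real.sqrt (n : ℝ)) * ∑ j ∈ Finset.range n, (g (shift^[j] x) - β1) with hY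
  have hYc : ∀ n, Continuous (Y n) := fun n =>
    continuous_const.mul (continuous_birkhoff (g := fun x => g x - β1)
      (hgc.sub continuous_const) n)
  have hYm : ∀ n, Measurable (Y n) := fun n => (hYc n).measurable
  let P : ℕ → ProbabilityMeasure ℝ := fun n =>
    ⟨μ.map (Y n), Measure.isProbabilityMeasure_map (hYm n).aemeasurable⟩
  have hP : ∀ n, (P n : Measure ℝ) = μ.map (Y n) := fun n => rfl
  let v : NNReal := ⟨σ2, hσ2.le⟩
  have hvσ : (v : ℝ) = σ2 := rfl
  have hv : v ≠ 0 := fun h => hσ2.ne' (by rw [← hvσ, h]; rfl)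
  let P0 : ProbabilityMeasure ℝ := ⟨gaussianReal 0 v, inferInstance⟩
  have hP0 : (P0 : Measure ℝ) = gaussianReal 0 v := rfl
  have hconv : Tendsto P atTop (𝓝 P0) := by
    apply curtiss
    · intro n z
      rw [hP, integrable_map_measure (by fun_prop) (hYm n).aemeasurable]
      have hc : Continuous ((fun x => Real.exp (z * x)) ∘ Y n) :=
        Real.continuous_exp.comp (continuous_const.mul (hYc n))
      exact hc.integrable_of_hasCompactSupport (HasCompactSupport.of_compactSpace _)
    · intro z
      exact integrable_exp_mul_gaussianReal z
    · intro z
      have e0 : ∫ x, Real.exp (z * x) ∂(P0 : Measure ℝ) = Real.exp (σ2 * z ^ 2 / 2) := by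
        have := congrFun (mgf_fun_id_gaussianReal (μ := 0) (v := v)) z
        rw [hP0]
        simpa [mgf, hvσ] using this
      rw [e0]
      have hT := (hspec z).mul (taylor_limit lam hlampos β1 σ2 hTaylor z)
      rw [one_mul] at hT
      refine hT.congr' ?_
      filter_upwards [eventually_gt_atTop 0] with n hn
      have hn' : (0 : ℝ) < n := by exact_mod_cast hn
      have hs : 0 < Real.sqrt n := Real.sqrt_pos.2 hn'
      have hss : Real.sqrt n * Real.sqrt n = n := Real.mul_self_sqrt hn'.le
      rw [hP, integral_map (hYm n).aemeasurable (by fun_prop),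
        integral_ruelle_iterate ν hfc μ hfix hgc _ n _ continuous_const]
      have hl : (lam (z / Real.sqrt n)) ^ n ≠ 0 := (pow_pos (hlampos _) n).ne'
      have e1 : ∀ x, Real.exp (z * Y n x) = Real.exp (-(z * Real.sqrt n * β1)) *
          (Real.exp (z / Real.sqrt n * ∑ j ∈ Finset.range n, g (shift^[j] x)) * 1) := by
        intro x
        rw [mul_one, ← Real.exp_add]
        congr 1
        simp only [hY, Finset.sum_sub_distrib, Finset.sum_const, Finset.card_range, nsmul_eq_mul]
        have e3 : (n : ℝ) * (z / Real.sqrt n) = z * Real.sqrt n := by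
          rw [mul_div_assoc', div_eq_iff hs.ne', mul_assoc, hss, mul_comm]
        linear_combination (-β1) * e3
      simp_rw [e1]
      rw [integral_const_mul]
      field_simp
  have hfr : (P0 : Measure ℝ) (frontier (Set.Iio c)) = 0 := by
    have := nullSingletonClass_gaussianReal (μ := 0) hv
    rw [frontier_Iio, hP0]
    exact measure_singleton c
  have hfin := ProbabilityMeasure.tendsto_measure_of_null_frontier_of_tendsto' hconv hfr
  have hfin2 := (ENNReal.tendsto_toReal (measure_ne_top (P0 : Measure ℝ) (Set.Iio c))).comp hfin
  rw [hP0, gauss_val hv c] at hfin2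
  refine hfin2.congr fun n => ?_
  simp only [Function.comp]
  rw [hP, Measure.map_apply (hYm n) measurableSet_Iio]
  rfl
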